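/- Let n, h, w be positive integers with 2w < h ≤ n and 4w² < n. Define the stopping index τ(x) for x ∈ [0,1]^n (with pairwise distinct coordinates) as the least t with h ≤ t ≤ n−1 such that x_t lies in the closed interval [y^{(t−1)}_{⌈t/2⌉−w}, y^{(t−1)}_{⌊t/2⌋+w}], where y^{(t−1)}_1 < ⋯ < y^{(t−1)}_{t−1} are the values x_1, …, x_{t−1} in increasing order; if no such t exists, set τ(x) = n. Then the probability (under Lebesgue product measure on [0,1]^n) of the event that x_{τ(x)} is the best, i.e., |x_{τ(x)} − 1/2| ≤ |x_i − 1/2| for all i, is at least ((2w−1)/(n·2^(n−1))) · gbinom(n−1, (n−1)/2 − w) · (h/(2w)) · (1 − (1 − 2w/h)^(n−h+1)). -/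

import Mathlib

open MeasureTheory

/-- The uniform probability measure on the cube `[0,1]^n`. -/
noncomputable def unifCube (n : ℕ) : Measure (Fin n → ℝ) :=
  Measure.pi fun _ => volume.restrict (Set.Icc 0 1)

/-- The `r`-th smallest value (`0`-indexed) among the coordinates of `x`. -/
noncomputable def orderStat {n : ℕ} (x : Fin n → ℝ) (r : Fin n) : ℝ :=
  x (Tuple.sort x r)

/-- The generalized binomial coefficient `gbinom n z = Γ(n+1) / (Γ(z+1) Γ(n-z+1))`. -/
noncomputable def gbinom (n : ℕ) (z : ℝ) : ℝ :=
  Real.Gamma (n + 1) / (Real.Gamma (z + 1) * Real.Gamma ((n : ℝ) - z + 1))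

/-- The algorithm `A(h, w)` stops at round `t` (rounds are `1`-based, `h ≤ t ≤ n-1`) if the
`t`-th revealed value `x_t` lies in `[y^{(t-1)}_{⌈t/2⌉ - w}, y^{(t-1)}_{⌊t/2⌋ + w}]`, where
`y^{(t-1)}_1 < ⋯ < y^{(t-1)}_{t-1}` are the previously revealed values in increasing order.
(Ranks of order statistics here are `0`-indexed, whence the shifts by `1`; with `2w < h ≤ t`
the stated index bounds indeed hold.) -/
def stops (n h w : ℕ) (x : Fin n → ℝ) (t : ℕ) : Prop :=
  h ≤ t ∧ t ≤ n - 1 ∧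
    ∃ (h1 : (t + 1) / 2 - w - 1 < t - 1) (h2 : t / 2 + w - 1 < t - 1) (hx : t - 1 < n),
      orderStat (fun i : Fin (t - 1) => x (Fin.castLE (by omega) i))
          ⟨(t + 1) / 2 - w - 1, h1⟩ ≤ x ⟨t - 1, hx⟩ ∧
      x ⟨t - 1, hx⟩ ≤ orderStat (fun i : Fin (t - 1) => x (Fin.castLE (by omega) i))
          ⟨t / 2 + w - 1, h2⟩

/-- The (`0`-indexed) stopping index of the algorithm `A(h, w)`: the least round `t` with
`h ≤ t ≤ n-1` at which the stopping condition holds, and `n` if there is no such round. -/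
noncomputable def tau (n h w : ℕ) (hn : 0 < n) (x : Fin n → ℝ) : Fin n :=
  ⟨sInf ({t | stops n h w x t} ∪ {n}) - 1, by
    have hle : sInf ({t | stops n h w x t} ∪ {n}) ≤ n := Nat.sInf_le (by simp)
    omega⟩

/-- The relative ranks (number of smaller predecessors) at which the algorithm with window `w`
accepts a value that has `s` predecessors. -/
def acceptRanks (w s : ℕ) : Finset ℕ :=
  Finset.Ico ((s + 2) / 2 - w) ((s + 1) / 2 + w)

/-- The number of subsets of an `s`-element set whose cardinality is an accepted rank. -/
def acceptCount (w s : ℕ) : ℕ :=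
  ∑ k ∈ acceptRanks w s, s.choose k

lemma card_acceptRanks_le (w s : ℕ) : (acceptRanks w s).card ≤ 2 * w := by
  rw [acceptRanks, Nat.card_Ico]
  omega

lemma le_card_acceptRanks {w s : ℕ} (h : 2 * w ≤ s) : 2 * w - 1 ≤ (acceptRanks w s).card := by
  rw [acceptRanks, Nat.card_Ico]
  omega

lemma choose_le_choose_of_le_of_add_le {N j k : ℕ} (hjk : j ≤ k) (hkN : j + k ≤ N) :
    N.choose j ≤ N.choose k := by
  have mono : ∀ m, j ≤ m → m ≤ N / 2 → N.choose j ≤ N.choose m := by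
    intro m hjm
    induction m, hjm using Nat.le_induction with
    | base => exact fun _ => le_rfl
    | succ m _ ih =>
      exact fun hm => (ih (by omega)).trans (Nat.choose_le_succ_of_lt_half_left (by omega))
  rcases le_or_gt k (N / 2) with hk | hk
  · exact mono k hjk hk
  · rw [← Nat.choose_symm (n := N) (k := k) (by omega)]
    exact mono _ (by omega) (by omega)

lemma sum_Ico_choose_add_two (s a b : ℕ) (hab : a ≤ b) :
    ∑ k ∈ Finset.Ico (a + 2) (b + 2), (s + 2).choose k + s.choose (a + 1) + s.choose b =
      4 * ∑ k ∈ Finset.Ico (a + 1) (b + 1), s.choose k + s.choose (b + 1) + s.choose a := by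
  induction b, hab using Nat.le_induction with
  | base => simp
  | succ b hb ih =>
    rw [Finset.sum_Ico_succ_top (show a + 2 ≤ b + 2 by omega),
      Finset.sum_Ico_succ_top (show a + 1 ≤ b + 1 by omega)]
    have e : (s + 2).choose (b + 2) =
        s.choose b + 2 * s.choose (b + 1) + s.choose (b + 2) := by
      rw [Nat.choose_succ_succ (s + 1), Nat.choose_succ_succ s, Nat.choose_succ_succ s (b + 1)]
      ring
    rw [e]
    linarith

lemma acceptCount_add_two_le {w s : ℕ} (hw : 0 < w) (hs : 2 * w ≤ s) :
    acceptCount w (s + 2) ≤ 4 * acceptCount w s := by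
  obtain ⟨a, ha⟩ : ∃ a, (s + 2) / 2 - w = a + 1 := ⟨(s + 2) / 2 - w - 1, by omega⟩
  obtain ⟨b, hb⟩ : ∃ b, (s + 1) / 2 + w = b + 1 := ⟨(s + 1) / 2 + w - 1, by omega⟩
  have key := sum_Ico_choose_add_two s a b (by omega)
  have h1 : s.choose a ≤ s.choose (a + 1) := choose_le_choose_of_le_of_add_le (by omega) (by omega)
  have h2 : s.choose b = s.choose (a + 1) := Nat.choose_symm_of_eq_add (by omega)
  have h3 : s.choose (b + 1) = s.choose a := Nat.choose_symm_of_eq_add (by omega)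
  rw [acceptCount, acceptCount, acceptRanks, acceptRanks,
    show (s + 2 + 2) / 2 - w = a + 2 by omega, show (s + 2 + 1) / 2 + w = b + 2 by omega, ha, hb]
  omega

lemma acceptCount_add_two_mul_le {w s : ℕ} (hw : 0 < w) (hs : 2 * w ≤ s) (j : ℕ) :
    acceptCount w (s + 2 * j) ≤ 2 ^ (2 * j) * acceptCount w s := by
  induction j with
  | zero => simp
  | succ j ih =>
    have h := acceptCount_add_two_le (s := s + 2 * j) hw (by omega)
    rw [show s + 2 * (j + 1) = s + 2 * j + 2 by ring, show 2 * (j + 1) = 2 * j + 2 by ring, pow_add]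
    linarith

lemma mul_choose_le_acceptCount {w N : ℕ} (hN : 2 * w ≤ N) :
    (2 * w - 1) * N.choose ((N + 1) / 2 - w) ≤ acceptCount w N := by
  refine (Nat.mul_le_mul_right _ (le_card_acceptRanks hN)).trans ?_
  rw [← smul_eq_mul, acceptCount]
  refine Finset.card_nsmul_le_sum _ _ _ fun k hk => ?_
  rw [acceptRanks, Finset.mem_Ico] at hk
  exact choose_le_choose_of_le_of_add_le (by omega) (by omega)

lemma two_mul_mul_choose_le_acceptCount_succ {w N : ℕ} (hw : 0 < w) (hN : 2 * w ≤ N) :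
    2 * ((2 * w - 1) * N.choose ((N + 1) / 2 - w)) ≤ acceptCount w (N + 1) := by
  have h : 2 * N.choose ((N + 1) / 2 - w) ≤ (N + 1).choose ((N + 1) / 2 - w + 1) := by
    rw [Nat.choose_succ_succ, two_mul]
    exact Nat.add_le_add_left (choose_le_choose_of_le_of_add_le (by omega) (by omega)) _
  rw [mul_left_comm]
  refine (Nat.mul_le_mul (le_card_acceptRanks (s := N + 1) (by omega)) h).trans ?_
  rw [← smul_eq_mul, acceptCount]
  refine Finset.card_nsmul_le_sum _ _ _ fun k hk => ?_
  rw [acceptRanks, Finset.mem_Ico] at hk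
  exact choose_le_choose_of_le_of_add_le (by omega) (by omega)

/-- The acceptance probability `acceptCount w s / 2 ^ s` is at least
`(2w - 1) C(N, ⌈N/2⌉ - w) / 2 ^ N` whenever `s ≤ N`. -/
lemma two_pow_mul_choose_le {w s N : ℕ} (hw : 0 < w) (hs : 2 * w ≤ s) (hsN : s ≤ N) :
    2 ^ s * ((2 * w - 1) * N.choose ((N + 1) / 2 - w)) ≤ 2 ^ N * acceptCount w s := by
  rcases Nat.even_or_odd' (N - s) with ⟨j, hj | hj⟩
  · obtain rfl : N = s + 2 * j := by omega
    have := (mul_choose_le_acceptCount (w := w) (N := s + 2 * j) (by omega)).trans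
      (acceptCount_add_two_mul_le hw hs j)
    rw [pow_add, mul_assoc]
    exact Nat.mul_le_mul_left _ this
  · obtain rfl : N = s + 2 * j + 1 := by omega
    have := (two_mul_mul_choose_le_acceptCount_succ (N := s + 2 * j + 1) hw (by omega)).trans
      (acceptCount_add_two_mul_le hw hs (j + 1))
    rw [add_assoc, pow_add, mul_assoc]
    refine Nat.mul_le_mul_left _ ?_
    rw [show 2 * (j + 1) = 2 * j + 1 + 1 by ring, pow_succ] at this
    rw [← add_assoc]
    linarith

lemma Gamma_mul_Gamma_le {a b c : ℝ} (ha : 0 < a) (hac : a ≤ c) (hcb : c ≤ b) :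
    Real.Gamma c * Real.Gamma (a + b - c) ≤ Real.Gamma a * Real.Gamma b := by
  rcases hac.eq_or_lt with rfl | hac
  · simp
  have hab : 0 < b - a := by linarith
  have hb : 0 < b := by linarith
  have hc : 0 < c := by linarith
  have hd : 0 < a + b - c := by linarith
  have hθ : 0 ≤ (c - a) / (b - a) := div_nonneg (by linarith) hab.le
  have hθ' : 0 ≤ (b - c) / (b - a) := div_nonneg (by linarith) hab.le
  have h1 := Real.convexOn_log_Gamma.2 (Set.mem_Ioi.2 ha) (Set.mem_Ioi.2 hb) hθ' hθ
    (by field_simp; ring)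
  have h2 := Real.convexOn_log_Gamma.2 (Set.mem_Ioi.2 ha) (Set.mem_Ioi.2 hb) hθ hθ'
    (by field_simp; ring)
  have e1 : (b - c) / (b - a) * a + (c - a) / (b - a) * b = c := by field_simp; ring
  have e2 : (c - a) / (b - a) * a + (b - c) / (b - a) * b = a + b - c := by field_simp; ring
  have e3 : (b - c) / (b - a) + (c - a) / (b - a) = 1 := by field_simp; ring
  simp only [smul_eq_mul, Function.comp_apply, e1, e2] at h1 h2
  have pa := Real.Gamma_pos_of_pos ha
  have pb := Real.Gamma_pos_of_pos hb
  have pc := Real.Gamma_pos_of_pos hc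
  have pd := Real.Gamma_pos_of_pos hd
  rw [← Real.log_le_log_iff (mul_pos pc pd) (mul_pos pa pb), Real.log_mul pc.ne' pd.ne',
    Real.log_mul pa.ne' pb.ne']
  linear_combination h1 + h2 + (Real.log (Real.Gamma a) + Real.log (Real.Gamma b)) * e3

lemma gbinom_le_choose {w N : ℕ} (hw : 0 < w) (hN : 2 * w ≤ N) :
    gbinom N ((N : ℝ) / 2 - w) ≤ N.choose ((N + 1) / 2 - w) := by
  set k := (N + 1) / 2 - w with hk
  have hwN : 2 * (w : ℝ) ≤ N := by exact_mod_cast hN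
  have hkN : k ≤ N := by omega
  have k1 : (N : ℝ) ≤ 2 * k + 2 * w := by
    have : N ≤ 2 * k + 2 * w := by omega
    exact_mod_cast this
  have k2 : (k : ℝ) ≤ N / 2 + w := by
    have : 2 * k ≤ N + 2 * w := by omega
    have : 2 * (k : ℝ) ≤ N + 2 * w := by exact_mod_cast this
    linarith
  have key := Gamma_mul_Gamma_le (a := (N : ℝ) / 2 - w + 1) (b := (N : ℝ) / 2 + w + 1)
    (c := k + 1) (by linarith) (by linarith) (by linarith)
  rw [Nat.cast_choose ℝ hkN, gbinom, ← Real.Gamma_nat_eq_factorial N,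
    ← Real.Gamma_nat_eq_factorial k, ← Real.Gamma_nat_eq_factorial (N - k), Nat.cast_sub hkN]
  refine div_le_div_of_nonneg_left (Real.Gamma_pos_of_pos (by positivity)).le ?_ ?_
  · refine mul_pos (Real.Gamma_pos_of_pos (by positivity)) (Real.Gamma_pos_of_pos ?_)
    have : (k : ℝ) ≤ N := by exact_mod_cast hkN
    linarith
  · rwa [show (N : ℝ) / 2 - w + 1 + (N / 2 + w + 1) - (k + 1) = N - k + 1 by ring,
      show (N : ℝ) / 2 + w + 1 = N - (N / 2 - w) + 1 by ring] at key

/-- The number of predecessors of `x s` that are smaller than `x s`. -/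
noncomputable def relRank {n : ℕ} (x : Fin n → ℝ) (s : Fin n) : ℕ :=
  (Finset.univ.filter fun i => i < s ∧ x i < x s).card

lemma orderStat_le_iff {m : ℕ} (y : Fin m → ℝ) (r : Fin m) (v : ℝ) :
    orderStat y r ≤ v ↔ (r : ℕ) < (Finset.univ.filter fun i => y i ≤ v).card := by
  have h := Tuple.lt_card_le_iff_apply_le_of_monotone (j := r) (a := v) (Tuple.monotone_sort y)
  have e : (Finset.univ.filter fun i => (y ∘ Tuple.sort y) i ≤ v).card =
      (Finset.univ.filter fun i => y i ≤ v).card :=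
    Finset.card_bij (fun i _ => Tuple.sort y i) (by simp) (by simp) fun b hb =>
      ⟨(Tuple.sort y).symm b, by simpa using hb, by simp⟩
  rw [e] at h
  exact h.symm

lemma orderStat_mem_range {m : ℕ} (y : Fin m → ℝ) (r : Fin m) : ∃ i, y i = orderStat y r :=
  ⟨_, rfl⟩

lemma card_filter_castLE_lt {n : ℕ} (x : Fin n → ℝ) (s : Fin n) (hs : (s : ℕ) ≤ n) :
    (Finset.univ.filter fun i : Fin s => x (Fin.castLE hs i) < x s).card = relRank x s :=
  Finset.card_bij (fun i _ => Fin.castLE hs i)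
    (fun i hi => by
      simp only [Finset.mem_filter, Finset.mem_univ, true_and] at hi ⊢
      exact ⟨Fin.lt_def.2 i.2, hi⟩)
    (fun _ _ _ _ hij => Fin.castLE_injective hs hij)
    fun b hb => by
      simp only [Finset.mem_filter, Finset.mem_univ, true_and] at hb
      exact ⟨⟨b, hb.1⟩, by simpa using hb.2, rfl⟩

lemma stops_iff_relRank_mem {n h w : ℕ} (hw : 0 < w) (hwh : 2 * w < h) {x : Fin n → ℝ}
    (hx : Function.Injective x) (s : Fin n) :
    stops n h w x (s + 1) ↔ h ≤ s + 1 ∧ (s : ℕ) + 1 ≤ n - 1 ∧ relRank x s ∈ acceptRanks w s := by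
  unfold stops
  refine and_congr_right fun h1 => and_congr_right fun h2 => ?_
  have hsn : (s : ℕ) ≤ n := s.2.le
  set y : Fin s → ℝ := fun i => x (Fin.castLE hsn i) with hy
  have hne : ∀ i, y i ≠ x s := fun i hi => by
    have := congrArg Fin.val (hx hi)
    simp at this
    omega
  have hc : (Finset.univ.filter fun i => y i ≤ x s).card = relRank x s := by
    rw [← card_filter_castLE_lt x s hsn]
    congr 1
    ext i
    simpa using ⟨fun hi => lt_of_le_of_ne hi (hne i), le_of_lt⟩
  have hlow : ∀ r : Fin s, orderStat y r ≤ x s ↔ (r : ℕ) < relRank x s := fun r => by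
    rw [orderStat_le_iff, hc]
  have hup : ∀ r : Fin s, x s ≤ orderStat y r ↔ relRank x s ≤ r := fun r => by
    obtain ⟨i, hi⟩ := orderStat_mem_range y r
    have : x s ≤ orderStat y r ↔ ¬ orderStat y r ≤ x s := by
      rw [not_le, ← hi]
      exact ⟨fun hh => lt_of_le_of_ne hh (hne i).symm, le_of_lt⟩
    rw [this, hlow, not_lt]
  rw [acceptRanks, Finset.mem_Ico]
  constructor
  · rintro ⟨k1, k2, _, hl, hu⟩
    have hl' := (hlow ⟨_, k1⟩).1 hl
    have hu' := (hup ⟨_, k2⟩).1 hu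
    dsimp only at hl' hu'
    omega
  · rintro ⟨hl, hu⟩
    exact ⟨by omega, by omega, s.2, (hlow ⟨(s + 1 + 1) / 2 - w - 1, by omega⟩).2 (by dsimp; omega),
      (hup ⟨(s + 1) / 2 + w - 1, by omega⟩).2 (by dsimp; omega)⟩

/-- The algorithm stops at `s` if `s` is the first round with an accepted rank. -/
lemma tau_eq {n h w : ℕ} (hn : 0 < n) (hw : 0 < w) (hwh : 2 * w < h) {x : Fin n → ℝ}
    (hx : Function.Injective x) {s : Fin n} (hs : h ≤ s + 1)
    (hacc : relRank x s ∈ acceptRanks w s)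
    (hrej : ∀ r < s, h ≤ r + 1 → relRank x r ∉ acceptRanks w r) : tau n h w hn x = s := by
  have key : sInf ({t | stops n h w x t} ∪ {n}) = s + 1 := by
    refine IsLeast.csInf_eq ⟨?_, ?_⟩
    · rcases Nat.lt_or_ge (s + 1) n with hsn | hsn
      · exact Or.inl ((stops_iff_relRank_mem hw hwh hx s).2 ⟨hs, by omega, hacc⟩)
      · exact Or.inr (Set.mem_singleton_iff.2 (by omega))
    · rintro t (ht | rfl)
      · by_contra hlt
        have h1 : h ≤ t := ht.1
        obtain ⟨r, rfl⟩ : ∃ r, t = r + 1 := ⟨t - 1, by omega⟩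
        have h2 := (stops_iff_relRank_mem hw hwh hx ⟨r, by omega⟩).1 ht
        exact hrej ⟨r, by omega⟩ (Fin.lt_def.2 (by dsimp; omega)) h1 h2.2.2
      · exact s.2
  ext
  change sInf ({t | stops n h w x t} ∪ {n}) - 1 = s
  rw [key, Nat.add_sub_cancel]

/-- Averaging principle: if the measure-preserving maps `f a`, `a ∈ I`, leave `G` invariant and
almost every orbit of a point of `G` meets `A` at least `c` times, then `A` has conditional
probability at least `c / #I` given `G`. -/
lemma card_mul_measureReal_le {Ω ι : Type*} [MeasurableSpace Ω] {μ : Measure Ω}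
    [IsFiniteMeasure μ] (I : Finset ι) {f : ι → Ω → Ω} (hf : ∀ a, MeasurePreserving (f a) μ μ)
    {A G : Set Ω} [DecidablePred (· ∈ A)] (hA : MeasurableSet A) (hG : MeasurableSet G)
    (hinv : ∀ a ∈ I, f a ⁻¹' G = G) (c : ℕ)
    (hc : ∀ᵐ x ∂μ, x ∈ G → c ≤ (I.filter fun a => f a x ∈ A).card) :
    c * μ.real G ≤ I.card * μ.real (A ∩ G) := by
  have key : (c : ENNReal) * μ G ≤ I.card * μ (A ∩ G) := by
    calc (c : ENNReal) * μ G = ∫⁻ _ in G, c ∂μ := by simp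
      _ ≤ ∫⁻ x in G, ∑ a ∈ I, (f a ⁻¹' A).indicator 1 x ∂μ := by
        refine lintegral_mono_ae ?_
        filter_upwards [ae_restrict_mem hG, ae_restrict_of_ae hc] with x hxG hx
        have : ∑ a ∈ I, (f a ⁻¹' A).indicator (1 : Ω → ENNReal) x =
            ((I.filter fun a => f a x ∈ A).card : ENNReal) := by
          rw [Finset.card_filter]
          push_cast
          refine Finset.sum_congr rfl fun a _ => ?_
          by_cases ha : f a x ∈ A <;> simp [ha]
        rw [this]
        exact_mod_cast hx hxG
      _ = ∑ a ∈ I, μ (A ∩ G) := by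
        rw [lintegral_finsetSum _ fun a _ => measurable_one.indicator ((hf a).measurable hA)]
        refine Finset.sum_congr rfl fun a ha => ?_
        rw [lintegral_indicator_one ((hf a).measurable hA),
          Measure.restrict_apply ((hf a).measurable hA),
          ← (hf a).measure_preimage (hA.inter hG).nullMeasurableSet, Set.preimage_inter, hinv a ha]
      _ = I.card * μ (A ∩ G) := by simp
  have := ENNReal.toReal_mono (by finiteness) key
  simpa [Measure.real] using this

instance : IsProbabilityMeasure ((volume : Measure ℝ).restrict (Set.Icc 0 1)) :=
  ⟨by simp⟩

instance (n : ℕ) : IsProbabilityMeasure (unifCube n) := by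
  unfold unifCube
  infer_instance

lemma measurePreserving_comp_perm {n : ℕ} (e : Equiv.Perm (Fin n)) :
    MeasurePreserving (fun x : Fin n → ℝ => x ∘ e) (unifCube n) (unifCube n) := by
  convert! measurePreserving_piCongrLeft
    (fun _ => (volume : Measure ℝ).restrict (Set.Icc 0 1)) e.symm using 1
  funext x i
  simp [MeasurableEquiv.coe_piCongrLeft, Equiv.piCongrLeft_apply]

/-- Reflection of the coordinates in `D` about `1/2`. -/
def reflectCoords {n : ℕ} (D : Finset (Fin n)) (x : Fin n → ℝ) (i : Fin n) : ℝ :=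
  if i ∈ D then 1 - x i else x i

lemma measurePreserving_reflectCoords {n : ℕ} (D : Finset (Fin n)) :
    MeasurePreserving (reflectCoords D) (unifCube n) (unifCube n) := by
  have h1 : MeasurePreserving (fun y : ℝ => 1 - y) (volume.restrict (Set.Icc 0 1))
      (volume.restrict (Set.Icc 0 1)) := by
    have := (Measure.measurePreserving_sub_left (volume : Measure ℝ) 1).restrict_preimage
      (measurableSet_Icc (a := (0 : ℝ)) (b := 1))
    simpa using this
  refine measurePreserving_pi _ _ (f := fun i y => if i ∈ D then 1 - y else y) fun i => ?_
  by_cases hi : i ∈ D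
  · simpa [hi] using h1
  · simpa only [hi, if_false] using! MeasurePreserving.id _

lemma ae_apply_ne {n : ℕ} {i j : Fin n} (hij : i ≠ j) : ∀ᵐ x ∂unifCube n, x i ≠ x j := by
  have hac : unifCube n ≪ volume := by
    rw [unifCube, ← Measure.restrict_pi_pi]
    exact Measure.restrict_le_self.absolutelyContinuous
  refine hac.ae_le ?_
  let L : (Fin n → ℝ) →ₗ[ℝ] ℝ := LinearMap.proj (R := ℝ) (φ := fun _ => ℝ) i - LinearMap.proj j
  have hL : LinearMap.ker L ≠ ⊤ := fun h => by
    have h2 : Pi.single i (1 : ℝ) ∈ LinearMap.ker L := h ▸ Submodule.mem_top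
    simp [L, hij.symm] at h2
  have h0 := Measure.addHaar_submodule (volume : Measure (Fin n → ℝ)) _ hL
  rw [mem_ae_iff]
  convert h0 using 2
  ext x
  simp [L, sub_eq_zero]

lemma ae_injective (n : ℕ) : ∀ᵐ x ∂unifCube n, Function.Injective x := by
  have : ∀ᵐ x ∂unifCube n, ∀ i j, i ≠ j → x i ≠ x j :=
    ae_all_iff.2 fun i => ae_all_iff.2 fun j => ae_all_iff.2 fun hij => ae_apply_ne hij
  filter_upwards [this] with x hx i j hij
  exact not_imp_not.1 (hx i j) hij

lemma ae_apply_ne_one_sub {n : ℕ} {i j : Fin n} (hij : i ≠ j) :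
    ∀ᵐ x ∂unifCube n, x i ≠ 1 - x j := by
  have := (measurePreserving_reflectCoords {j}).quasiMeasurePreserving.ae (ae_apply_ne hij)
  filter_upwards [this] with x hx
  simpa [reflectCoords, hij] using hx

/-- The event that the `s`-th coordinate is closest to `1/2`. -/
def bestAt {n : ℕ} (s : Fin n) : Set (Fin n → ℝ) :=
  {x | ∀ i, |x s - 1/2| ≤ |x i - 1/2|}

/-- The event that the rank of the `s`-th coordinate is accepted. -/
def accepts {n : ℕ} (w : ℕ) (s : Fin n) : Set (Fin n → ℝ) :=
  {x | relRank x s ∈ acceptRanks w s}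

/-- The event that the `s`-th coordinate is the best, has an accepted rank, and no earlier
coordinate from round `m` on has an accepted rank. -/
def firstAcceptsBest {n : ℕ} (m w : ℕ) (s : Fin n) : Set (Fin n → ℝ) :=
  {x | ∀ r < s, m ≤ r + 1 → x ∉ accepts w r} ∩ (accepts w s ∩ bestAt s)

lemma measurableSet_bestAt {n : ℕ} (s : Fin n) : MeasurableSet (bestAt s) := by
  refine MeasurableSet.of_compl ?_
  have : (bestAt s)ᶜ = ⋃ i, {x : Fin n → ℝ | |x i - 1/2| < |x s - 1/2|} := by
    ext x
    simp [bestAt]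
  rw [this]
  exact MeasurableSet.iUnion fun i => measurableSet_lt (by fun_prop) (by fun_prop)

lemma measurable_relRank {n : ℕ} (s : Fin n) : Measurable fun x : Fin n → ℝ => relRank x s := by
  simp only [relRank, Finset.card_filter]
  refine Finset.measurable_sum _ fun i _ => Measurable.ite ?_ measurable_const measurable_const
  exact (MeasurableSet.const _).inter
    (measurableSet_lt (measurable_pi_apply i) (measurable_pi_apply s))

lemma measurableSet_accepts {n : ℕ} (w : ℕ) (s : Fin n) : MeasurableSet (accepts w s) :=
  measurable_relRank s (acceptRanks w s).measurableSet

lemma measurableSet_firstAcceptsBest {n : ℕ} (m w : ℕ) (s : Fin n) :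
    MeasurableSet (firstAcceptsBest m w s) := by
  refine MeasurableSet.inter ?_ ((measurableSet_accepts w s).inter (measurableSet_bestAt s))
  simp only [Set.ofPred_forall]
  exact MeasurableSet.iInter fun r => MeasurableSet.iInter fun _ => MeasurableSet.iInter fun _ =>
    (measurableSet_accepts w r).compl

lemma relRank_comp_perm {n : ℕ} (x : Fin n → ℝ) {e : Equiv.Perm (Fin n)} {s : Fin n}
    (he : ∀ i, e i ≤ s ↔ i ≤ s) :
    relRank (x ∘ e) s = ((Finset.Iic s).filter fun i => x i < x (e s)).card := by
  refine Finset.card_bij (fun i _ => e i) (fun i hi => ?_) (fun _ _ _ _ h => e.injective h)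
    fun b hb => ⟨e.symm b, ?_, by simp⟩
  · simp only [Finset.mem_filter, Finset.mem_univ, true_and, Finset.mem_Iic] at hi ⊢
    exact ⟨(he i).2 hi.1.le, hi.2⟩
  · simp only [Finset.mem_filter, Finset.mem_univ, true_and, Finset.mem_Iic,
      Function.comp_apply, Equiv.apply_symm_apply] at hb ⊢
    refine ⟨lt_of_le_of_ne ((he _).1 (by simpa using hb.1)) ?_, hb.2⟩
    rintro rfl
    simp at hb

lemma swap_le_iff {n : ℕ} {j r s : Fin n} (hj : j ≤ s) (hr : r ≤ s) (i : Fin n) :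
    Equiv.swap j r i ≤ s ↔ i ≤ s := by
  rw [Equiv.swap_apply_def]
  split_ifs with h1 h2
  · simp [h1, hj, hr]
  · simp [h2, hj, hr]
  · rfl

lemma relRank_comp_swap_of_lt {n : ℕ} (x : Fin n → ℝ) {j r s : Fin n} (hj : j ≤ r) (hr : r < s) :
    relRank (x ∘ Equiv.swap j r) s = relRank x s := by
  have h := relRank_comp_perm x (e := 1) (s := s) (by simp)
  rw [relRank_comp_perm x (swap_le_iff (hj.trans hr.le) hr.le),
    Equiv.swap_apply_of_ne_of_ne (hj.trans_lt hr).ne' hr.ne']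
  simpa using! h.symm

lemma comp_swap_mem_bestAt_iff {n : ℕ} (x : Fin n → ℝ) (j r s : Fin n) :
    x ∘ Equiv.swap j r ∈ bestAt s ↔ ∀ i, |x (Equiv.swap j r s) - 1/2| ≤ |x i - 1/2| :=
  (Equiv.swap j r).forall_congr_left.trans (by simp)

lemma comp_swap_mem_firstAcceptsBest_iff {n m w : ℕ} (x : Fin n → ℝ) {j r s : Fin n}
    (hj : j ≤ r) (hr : r < s) (hm : (r : ℕ) + 1 < m) :
    x ∘ Equiv.swap j r ∈ firstAcceptsBest m w s ↔ x ∈ firstAcceptsBest m w s := by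
  refine and_congr (forall_congr' fun q => imp_congr_right fun _ => imp_congr_right fun hq => ?_)
    (and_congr ?_ ?_)
  · have hrq : r < q := Fin.lt_def.2 (by omega)
    simp only [accepts, Set.mem_ofPred_eq, relRank_comp_swap_of_lt x hj hrq]
  · simp only [accepts, Set.mem_ofPred_eq, relRank_comp_swap_of_lt x hj hr]
  · rw [comp_swap_mem_bestAt_iff, Equiv.swap_apply_of_ne_of_ne (hj.trans_lt hr).ne' hr.ne']
    rfl

lemma one_le_mul_measureReal_bestAt {n : ℕ} (s : Fin n) :
    1 ≤ n * (unifCube n).real (bestAt s) := by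
  classical
  have h := card_mul_measureReal_le (μ := unifCube n) Finset.univ
    (f := fun j x => x ∘ Equiv.swap j s) (fun j => measurePreserving_comp_perm _)
    (measurableSet_bestAt s) MeasurableSet.univ (by simp) 1 (.of_forall fun x _ => ?_)
  · simpa using h
  · have : Nonempty (Fin n) := ⟨s⟩
    obtain ⟨j, hj⟩ := Finite.exists_min fun i => |x i - 1/2|
    refine Finset.card_pos.2 ⟨j, Finset.mem_filter.2 ⟨Finset.mem_univ _, ?_⟩⟩
    rw [comp_swap_mem_bestAt_iff, Equiv.swap_apply_right]
    exact hj

lemma card_filter_accepts_comp_swap_le {n : ℕ} {w : ℕ} {x : Fin n → ℝ}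
    (hx : Function.Injective x) (r : Fin n)
    [DecidablePred fun j => x ∘ Equiv.swap j r ∈ accepts w r] :
    ((Finset.Iic r).filter fun j => x ∘ Equiv.swap j r ∈ accepts w r).card ≤ 2 * w := by
  refine le_trans (Finset.card_le_card_of_injOn
    (fun j => ((Finset.Iic r).filter fun i => x i < x j).card) (fun j hj => ?_) ?_)
    (card_acceptRanks_le w r)
  · obtain ⟨hj, hacc⟩ := Finset.mem_filter.1 hj
    rw [accepts, Set.mem_ofPred_eq, relRank_comp_perm x (swap_le_iff (Finset.mem_Iic.1 hj) le_rfl),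
      Equiv.swap_apply_right] at hacc
    exact hacc
  · have mono : ∀ j ∈ Finset.Iic r, ∀ k, x j < x k →
        ((Finset.Iic r).filter fun i => x i < x j).card <
          ((Finset.Iic r).filter fun i => x i < x k).card := fun j hj k hjk =>
      Finset.card_lt_card ((Finset.ssubset_iff_of_subset
        (Finset.monotone_filter_right _ fun i _ hi => hi.trans hjk)).2
        ⟨j, Finset.mem_filter.2 ⟨hj, hjk⟩, by simp⟩)
    intro j hj k hk hjk
    by_contra hne
    rcases lt_or_gt_of_ne (hx.ne hne) with hlt | hlt
    · exact (mono j (Finset.mem_filter.1 hj).1 k hlt).ne hjk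
    · exact (mono k (Finset.mem_filter.1 hk).1 j hlt).ne' hjk

lemma sub_mul_measureReal_le_reject {n w : ℕ} (r : Fin n) {G : Set (Fin n → ℝ)}
    (hG : MeasurableSet G) (hinv : ∀ j ≤ r, ∀ x, x ∘ Equiv.swap j r ∈ G ↔ x ∈ G) :
    ((r : ℕ) + 1 - 2 * w : ℝ) * (unifCube n).real G ≤
      ((r : ℕ) + 1) * (unifCube n).real ((accepts w r)ᶜ ∩ G) := by
  classical
  have h := card_mul_measureReal_le (μ := unifCube n) (Finset.Iic r)
    (f := fun j x => x ∘ Equiv.swap j r) (fun j => measurePreserving_comp_perm _)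
    (measurableSet_accepts w r).compl hG
    (fun j hj => Set.ext fun x => hinv j (Finset.mem_Iic.1 hj) x) (r + 1 - 2 * w) ?_
  · have hle : ((r : ℕ) + 1 - 2 * w : ℝ) ≤ ((r + 1 - 2 * w : ℕ) : ℝ) := by
      have : (r : ℕ) + 1 ≤ r + 1 - 2 * w + 2 * w := by omega
      have : ((r : ℕ) : ℝ) + 1 ≤ ((r + 1 - 2 * w : ℕ) : ℝ) + 2 * w := by exact_mod_cast this
      linarith
    refine (mul_le_mul_of_nonneg_right hle measureReal_nonneg).trans ?_
    simpa using h
  · filter_upwards [ae_injective n] with x hx _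
    have h1 := card_filter_accepts_comp_swap_le (w := w) hx r
    have h2 := Finset.card_filter_add_card_filter_not (s := Finset.Iic r)
      (fun j => x ∘ Equiv.swap j r ∈ accepts w r)
    rw [Fin.card_Iic] at h2
    simp only [Set.mem_compl_iff]
    omega

lemma pow_mul_measureReal_le {n h w : ℕ} (hwh : 2 * w < h) (s : Fin n) (k : ℕ)
    (hk : h + k ≤ s + 1) :
    (1 - 2 * (w : ℝ) / h) ^ k * (unifCube n).real (accepts w s ∩ bestAt s) ≤
      (unifCube n).real (firstAcceptsBest (s + 1 - k) w s) := by
  have hh : (0 : ℝ) < h := by exact_mod_cast (by omega : 0 < h)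
  have hw2 : 2 * (w : ℝ) < h := by exact_mod_cast hwh
  have hq : 0 ≤ 1 - 2 * (w : ℝ) / h := by
    rw [sub_nonneg, div_le_one hh]
    exact hw2.le
  induction k with
  | zero =>
    rw [pow_zero, one_mul]
    refine measureReal_mono fun x hx => ⟨fun r hr hs => ?_, hx⟩
    have := Fin.lt_def.1 hr
    omega
  | succ k ih =>
    let r : Fin n := ⟨s + 1 - k - 2, by omega⟩
    have hrv : (r : ℕ) = s + 1 - k - 2 := rfl
    have hrs : r < s := Fin.lt_def.2 (by omega)
    have hrm : (r : ℕ) + 1 < s + 1 - k := by omega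
    have hstep := sub_mul_measureReal_le_reject (w := w) r
      (measurableSet_firstAcceptsBest (s + 1 - k) w s)
      fun j hj x => comp_swap_mem_firstAcceptsBest_iff x hj hrs hrm
    have hsub : (accepts w r)ᶜ ∩ firstAcceptsBest (s + 1 - k) w s ⊆
        firstAcceptsBest (s + 1 - (k + 1)) w s := by
      rintro x ⟨hxr, hx, hx'⟩
      refine ⟨fun q hq hm => ?_, hx'⟩
      rcases eq_or_ne q r with rfl | hqr
      · exact hxr
      · have : (q : ℕ) ≠ r := fun h => hqr (Fin.ext h)
        exact hx q hq (by omega)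
    have hmono := measureReal_mono (μ := unifCube n) hsub
    have hhr : (h : ℝ) ≤ (r : ℕ) + 1 := by exact_mod_cast (by omega : h ≤ (r : ℕ) + 1)
    have hr0 : (0 : ℝ) < (r : ℕ) + 1 := by positivity
    have hqr : 1 - 2 * (w : ℝ) / h ≤ ((r : ℕ) + 1 - 2 * w : ℝ) / ((r : ℕ) + 1) := by
      rw [sub_div, div_self hr0.ne']
      gcongr
    calc (1 - 2 * (w : ℝ) / h) ^ (k + 1) * (unifCube n).real (accepts w s ∩ bestAt s)
        = (1 - 2 * (w : ℝ) / h) *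
            ((1 - 2 * (w : ℝ) / h) ^ k * (unifCube n).real (accepts w s ∩ bestAt s)) := by ring
      _ ≤ ((r : ℕ) + 1 - 2 * w : ℝ) / ((r : ℕ) + 1) *
            (unifCube n).real (firstAcceptsBest (s + 1 - k) w s) :=
          mul_le_mul hqr (ih (by omega)) (by positivity) (hq.trans hqr)
      _ ≤ (unifCube n).real ((accepts w r)ᶜ ∩ firstAcceptsBest (s + 1 - k) w s) := by
          rw [div_mul_eq_mul_div, div_le_iff₀' hr0]
          exact hstep
      _ ≤ _ := hmono

lemma card_filter_powerset_symmDiff {α : Type*} [DecidableEq α] {S J : Finset α} (hJ : J ⊆ S)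
    (R : Finset ℕ) :
    (S.powerset.filter fun D => (symmDiff D J).card ∈ R).card = ∑ k ∈ R, S.card.choose k := by
  have h1 : (S.powerset.filter fun D => (symmDiff D J).card ∈ R).card =
      (S.powerset.filter fun D => D.card ∈ R).card := by
    have hsub : ∀ D ⊆ S, symmDiff D J ⊆ S := fun D hD =>
      Finset.union_subset (Finset.sdiff_subset.trans hD) (Finset.sdiff_subset.trans hJ)
    refine Finset.card_bij (fun D _ => symmDiff D J) (fun D hD => ?_)
      (fun _ _ _ _ h => symmDiff_left_injective J h) fun D hD => ⟨symmDiff D J, ?_, ?_⟩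
    · simp only [Finset.mem_filter, Finset.mem_powerset] at hD ⊢
      exact ⟨hsub D hD.1, hD.2⟩
    · simp only [Finset.mem_filter, Finset.mem_powerset, symmDiff_symmDiff_cancel_right] at hD ⊢
      exact ⟨hsub D hD.1, hD.2⟩
    · exact symmDiff_symmDiff_cancel_right _ _
  have h2 : Set.MapsTo Finset.card (S.powerset.filter fun D => D.card ∈ R : Set (Finset α)) R :=
    fun D hD => (Finset.mem_filter.1 hD).2
  rw [h1, Finset.card_eq_sum_card_fiberwise h2]
  refine Finset.sum_congr rfl fun k hk => ?_
  rw [← Finset.card_powersetCard, Finset.filter_filter]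
  congr 1
  ext D
  simp only [Finset.mem_filter, Finset.mem_powerset, Finset.mem_powersetCard]
  refine and_congr_right fun _ => ⟨fun h => h.2, fun h => ⟨h ▸ hk, h⟩⟩

lemma abs_reflectCoords {n : ℕ} (D : Finset (Fin n)) (x : Fin n → ℝ) (i : Fin n) :
    |reflectCoords D x i - 1/2| = |x i - 1/2| := by
  unfold reflectCoords
  split_ifs
  · rw [← abs_neg]
    ring_nf
  · rfl

lemma one_sub_lt_iff {u v : ℝ} (h : |u - 1/2| ≤ |v - 1/2|) (h1 : v ≠ u) (h2 : v ≠ 1 - u) :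
    1 - v < u ↔ ¬ v < u := by
  rcases abs_cases (u - 1/2) with ⟨hu, _⟩ | ⟨hu, _⟩ <;>
  rcases abs_cases (v - 1/2) with ⟨hv, _⟩ | ⟨hv, _⟩ <;>
  rw [hu, hv] at h <;> rcases lt_or_gt_of_ne h1 with h1 | h1 <;>
  rcases lt_or_gt_of_ne h2 with h2 | h2 <;>
  constructor <;> intro _ <;> linarith

lemma acceptCount_mul_measureReal_bestAt_le {n : ℕ} (w : ℕ) (s : Fin n) :
    acceptCount w s * (unifCube n).real (bestAt s) ≤
      2 ^ (s : ℕ) * (unifCube n).real (accepts w s ∩ bestAt s) := by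
  classical
  have h := card_mul_measureReal_le (μ := unifCube n) (Finset.Iio s).powerset
    (f := reflectCoords) measurePreserving_reflectCoords
    (measurableSet_accepts w s) (measurableSet_bestAt s)
    (fun D _ => Set.ext fun x => by simp only [bestAt, Set.mem_preimage, Set.mem_ofPred_eq,
      abs_reflectCoords]) (acceptCount w s) ?_
  · simpa [Finset.card_powerset, Fin.card_Iio] using h
  have hae : ∀ᵐ x ∂unifCube n, ∀ i, i ≠ s → x i ≠ x s ∧ x i ≠ 1 - x s :=
    ae_all_iff.2 fun i => ae_all_iff.2 fun hi => (ae_apply_ne hi).and (ae_apply_ne_one_sub hi)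
  filter_upwards [hae] with x hx hbest
  set J := (Finset.Iio s).filter fun i => x i < x s with hJ
  have hrank : ∀ D ⊆ Finset.Iio s, relRank (reflectCoords D x) s = (symmDiff D J).card := by
    intro D hD
    have hs : s ∉ D := fun hs => lt_irrefl s (Finset.mem_Iio.1 (hD hs))
    rw [relRank]
    congr 1
    ext i
    simp only [Finset.mem_filter, Finset.mem_univ, true_and, Finset.mem_symmDiff, hJ,
      Finset.mem_Iio, reflectCoords, if_neg hs]
    by_cases hi : i < s
    · have key := one_sub_lt_iff (hbest i) (hx i hi.ne).1 (hx i hi.ne).2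
      by_cases hiD : i ∈ D <;> simp [hi, hiD, key]
    · have hiD : i ∉ D := fun hiD => hi (Finset.mem_Iio.1 (hD hiD))
      simp [hi, hiD]
  have hcard := card_filter_powerset_symmDiff (Finset.filter_subset _ _ : J ⊆ Finset.Iio s)
    (acceptRanks w s)
  rw [Fin.card_Iio] at hcard
  rw [acceptCount, ← hcard]
  refine Finset.card_le_card fun D hD => ?_
  obtain ⟨hDs, hDR⟩ := Finset.mem_filter.1 hD
  refine Finset.mem_filter.2 ⟨hDs, ?_⟩
  rw [accepts, Set.mem_ofPred_eq, hrank D (Finset.mem_powerset.1 hDs)]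
  exact hDR

lemma pairwise_disjoint_firstAcceptsBest {n h w : ℕ} :
    ({s : Fin n | h ≤ s + 1}).PairwiseDisjoint (firstAcceptsBest h w) := by
  intro s hs t ht hst
  rw [Function.onFun, Set.disjoint_left]
  rintro x ⟨h1, h2⟩ ⟨h3, h4⟩
  rcases lt_or_gt_of_ne hst with hlt | hlt
  · exact h3 s hlt hs h2.1
  · exact h1 t hlt ht h4.1

/-- Lower bound for the success probability of the algorithm `A(h, w)`: if `2w < h ≤ n` and
`4w² < n`, the probability that the value it stops on is closest to `1/2` is at least
`((2w-1)/(n·2^(n-1))) · gbinom (n-1) ((n-1)/2 - w) · (h/(2w)) · (1 - (1 - 2w/h)^(n-h+1))`. -/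
theorem algA_success_lower_bound (n h w : ℕ) (hw : 0 < w) (hwh : 2 * w < h) (hhn : h ≤ n)
    (hwn : 4 * w ^ 2 < n) :
    ENNReal.ofReal ((2 * (w : ℝ) - 1) / (n * 2 ^ (n - 1)) *
        gbinom (n - 1) (((n : ℝ) - 1) / 2 - w) * ((h : ℝ) / (2 * w)) *
        (1 - (1 - 2 * (w : ℝ) / h) ^ (n - h + 1))) ≤
      unifCube n {x | ∀ i, |x (tau n h w (by omega) x) - 1/2| ≤ |x i - 1/2|} := by
  have hn : 0 < n := by omega
  have hn0 : (0 : ℝ) < n := by exact_mod_cast hn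
  have hw0 : (0 : ℝ) < w := by exact_mod_cast hw
  have hw1 : (1 : ℝ) ≤ w := by exact_mod_cast hw
  have hh0 : (0 : ℝ) < h := by exact_mod_cast (by omega : 0 < h)
  have hw2 : 2 * (w : ℝ) < h := by exact_mod_cast hwh
  set q : ℝ := 1 - 2 * (w : ℝ) / h with hq
  have hq0 : 0 ≤ q := by
    rw [hq, sub_nonneg, div_le_one hh0]
    exact hw2.le
  set c : ℝ := (2 * (w : ℝ) - 1) / (n * 2 ^ (n - 1)) * gbinom (n - 1) (((n : ℝ) - 1) / 2 - w)
    with hc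
  let T : Finset (Fin n) := Finset.univ.filter fun s => h ≤ s + 1
  have hT : ∀ s ∈ T, h ≤ (s : ℕ) + 1 := fun s hs => (Finset.mem_filter.1 hs).2
  have hacc : ∀ s ∈ T, c ≤ (unifCube n).real (accepts w s ∩ bestAt s) := by
    intro s hs
    have hs := hT s hs
    have h1 := acceptCount_mul_measureReal_bestAt_le w s
    have h2 := one_le_mul_measureReal_bestAt s
    have h3 := two_pow_mul_choose_le (w := w) (s := s) (N := n - 1) hw (by omega) (by omega)
    have h4 := gbinom_le_choose (w := w) (N := n - 1) hw (by omega)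
    rw [Nat.cast_pred hn] at h4
    have h5 : (2 : ℝ) ^ (s : ℕ) * ((2 * w - 1) * (n - 1).choose ((n - 1 + 1) / 2 - w)) ≤
        2 ^ (n - 1) * acceptCount w s := by
      have : ((2 * w - 1 : ℕ) : ℝ) = 2 * w - 1 := by
        rw [Nat.cast_sub (by omega)]
        push_cast
        ring
      rw [← this]
      exact_mod_cast h3
    have h6 : (2 : ℝ) ^ (s : ℕ) * ((2 * w - 1) * gbinom (n - 1) (((n : ℝ) - 1) / 2 - w)) ≤
        2 ^ (n - 1) * acceptCount w s :=
      le_trans (by gcongr; linarith) h5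
    have h7 : (acceptCount w s : ℝ) ≤
        n * (2 ^ (s : ℕ) * (unifCube n).real (accepts w s ∩ bestAt s)) := by
      have := mul_le_mul_of_nonneg_left h2 (Nat.cast_nonneg (α := ℝ) (acceptCount w s))
      nlinarith [mul_le_mul_of_nonneg_left h1 hn0.le]
    rw [hc, div_mul_eq_mul_div, div_le_iff₀ (by positivity)]
    refine le_of_mul_le_mul_left ?_ (by positivity : (0 : ℝ) < 2 ^ (s : ℕ))
    refine h6.trans ((mul_le_mul_of_nonneg_left h7 (by positivity)).trans_eq ?_)
    ring
  have hterm : ∀ s ∈ T, q ^ ((s : ℕ) + 1 - h) * c ≤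
      (unifCube n).real (firstAcceptsBest h w s) := by
    intro s hs
    have hle := hT s hs
    have := pow_mul_measureReal_le hwh s (s + 1 - h) (by omega)
    rw [show (s : ℕ) + 1 - (s + 1 - h) = h by omega] at this
    exact (mul_le_mul_of_nonneg_left (hacc s hs) (pow_nonneg hq0 _)).trans this
  have hgeom : ∑ s ∈ T, q ^ ((s : ℕ) + 1 - h) = (h : ℝ) / (2 * w) * (1 - q ^ (n - h + 1)) := by
    have e : ∑ s ∈ T, q ^ ((s : ℕ) + 1 - h) = ∑ k ∈ Finset.range (n - h + 1), q ^ k := by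
      refine Finset.sum_bij (fun s _ => (s : ℕ) + 1 - h) (fun s hs => ?_) (fun s hs t ht hst => ?_)
        (fun k hk => ?_) fun _ _ => rfl
      · have := hT s hs
        exact Finset.mem_range.2 (by omega)
      · have := hT s hs
        have := hT t ht
        exact Fin.ext (by omega)
      · have := Finset.mem_range.1 hk
        exact ⟨⟨h + k - 1, by omega⟩, Finset.mem_filter.2 ⟨Finset.mem_univ _, by dsimp; omega⟩,
          by dsimp; omega⟩
    have hq1 : q - 1 = -(2 * w / h) := by rw [hq]; ring
    have hq2 : q ≠ 1 := fun h1 => by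
      have : 0 < 2 * (w : ℝ) / h := by positivity
      linarith
    rw [e, geom_sum_eq hq2, hq1]
    field_simp
    ring
  have hunion : (unifCube n) (⋃ s ∈ T, firstAcceptsBest h w s) ≤
      unifCube n {x | ∀ i, |x (tau n h w (by omega) x) - 1/2| ≤ |x i - 1/2|} := by
    refine measure_mono_ae ?_
    filter_upwards [ae_injective n] with x hx hxU
    obtain ⟨s, hs, hxs⟩ := Set.mem_iUnion₂.1 hxU
    have htau := tau_eq hn hw hwh hx (hT s hs) hxs.2.1 hxs.1
    intro i
    rw [htau]
    exact hxs.2.2 i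
  refine le_trans ?_ hunion
  rw [← ofReal_measureReal (measure_ne_top _ _), measureReal_biUnion_finset
    (pairwise_disjoint_firstAcceptsBest.subset fun s hs => hT s hs)
    fun s _ => measurableSet_firstAcceptsBest h w s]
  refine ENNReal.ofReal_le_ofReal ?_
  calc c * ((h : ℝ) / (2 * w)) * (1 - q ^ (n - h + 1))
      = ∑ s ∈ T, q ^ ((s : ℕ) + 1 - h) * c := by
        rw [← Finset.sum_mul, hgeom]
        ring
    _ ≤ _ := Finset.sum_le_sum hterm
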